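/- arXiv:2408.04287 — 4 statements merged into one kernel-verified Lean document; each statement's English description precedes it below -/
import Mathlib

section
/- Let A be a set and let ⟨B_n⟩_{n∈ω} be a family of sets such that A ∩ B_n = ∅ for every n ∈ ω, and let ⟨f_n⟩_{n∈ω} be a family of functions such that for every n ∈ ω, f_n is a partial surjection from A onto A ∪ B_n. Then there exists a partial surjection g from A onto A ∪ ⋃_{n∈ω} B_n. -/
/-- `f` is a partial surjection from the set `A` onto the set `B`:
its domain is a subset of `A` and its range is exactly `B`. -/
def IsPartialSurjOn {α : Type*} (f : α →. α) (A B : Set α) : Prop :=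
  f.Dom ⊆ A ∧ f.ran = B

open Cardinal in
theorem exists_isPartialSurjOn_iff_mk_le {α : Type*} {A B : Set α} :
    (∃ f : α →. α, IsPartialSurjOn f A B) ↔ #B ≤ #A := by
  constructor
  · rintro ⟨f, hdom, rfl⟩
    refine le_trans ?_ (mk_le_mk_of_subset hdom)
    refine mk_le_of_surjective (f := fun x : f.Dom => ⟨f.asSubtype x, x, Part.get_mem x.2⟩) ?_
    rintro ⟨y, x, hx⟩
    obtain ⟨h, hxy⟩ := hx
    exact ⟨⟨x, h⟩, Subtype.ext hxy⟩
  · rintro ⟨e⟩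
    refine ⟨fun a => ⟨∃ b : B, (e b : α) = a, fun h => (h.choose : α)⟩, ?_, ?_⟩
    · rintro _ ⟨b, rfl⟩
      exact (e b).2
    · ext y
      constructor
      · rintro ⟨_, h, rfl⟩
        exact h.choose.2
      · intro hy
        have h : ∃ b : B, (e b : α) = e ⟨y, hy⟩ := ⟨_, rfl⟩
        have hchoose : h.choose = ⟨y, hy⟩ := e.injective (Subtype.ext h.choose_spec)
        exact ⟨e ⟨y, hy⟩, h, congrArg Subtype.val hchoose⟩

open Cardinal in
theorem Cardinal.mk_union_iUnion_le {α : Type*} {A : Set α} {B : ℕ → Set α}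
    (h : ∀ n, #(A ∪ B n : Set α) ≤ #A) : #(A ∪ ⋃ n, B n : Set α) ≤ #A := by
  rcases A.finite_or_infinite with hA | hA
  · have hB : ∀ n, B n ⊆ A := fun n => by
      have heq : A = A ∪ B n := hA.eq_of_subset_of_encard_le Set.subset_union_left
        (toENat.monotone' (h n))
      exact heq ▸ Set.subset_union_right
    rw [Set.union_eq_left.2 (Set.iUnion_subset hB)]
  · have hA' : ℵ₀ ≤ #A := infinite_iff.1 hA.to_subtype
    rw [Set.union_iUnion]
    have hle := mk_iUnion_le_lift fun n => A ∪ B n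
    rw [lift_uzero, mk_nat, lift_aleph0] at hle
    refine hle.trans (mul_le_of_le hA' hA' ?_)
    exact ciSup_le' fun n => by simpa using h n

theorem stmt_0 {α : Type*} (A : Set α) (B : ℕ → Set α) (f : ℕ → (α →. α))
    (hdisj : ∀ n, A ∩ B n = ∅)
    (hf : ∀ n, IsPartialSurjOn (f n) A (A ∪ B n)) :
    ∃ g : α →. α, IsPartialSurjOn g A (A ∪ ⋃ n, B n) :=
  exists_isPartialSurjOn_iff_mk_le.2 <| Cardinal.mk_union_iUnion_le fun n =>
    exists_isPartialSurjOn_iff_mk_le.1 ⟨f n, hf n⟩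
end

section
/- Let A be a set and let f be a function such that A ⊆ f[A] (the image of A under f contains A). Then there exists a partial surjection g from A onto ⋃_{n∈ω} f^n[A], where f^n denotes the n-fold iterate of f and f^n[A] its image of A. -/
/-- The partial inverse of an embedding of `B` into `A` is a partial surjection from `A` onto `B`. -/
theorem exists_isPartialSurjOn_of_embedding {α : Type*} {A B : Set α} (e : B ↪ A) :
    ∃ g : α →. α, IsPartialSurjOn g A B := by
  refine ⟨fun a => ⟨∃ b : B, (e b : α) = a, fun h => (h.choose : α)⟩, ?_, ?_⟩
  · rintro a ⟨b, rfl⟩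
    exact (e b).2
  · ext b
    constructor
    · rintro ⟨a, h, rfl⟩
      exact h.choose.2
    · intro hb
      have h : ∃ b' : B, (e b' : α) = e ⟨b, hb⟩ := ⟨⟨b, hb⟩, rfl⟩
      exact ⟨e ⟨b, hb⟩, h, congrArg Subtype.val (e.injective (Subtype.ext h.choose_spec))⟩

/-- If `A ⊆ f '' A`, the union of the iterated images of `A` is no larger than `A`. -/
theorem mk_iUnion_iterate_image_le {α : Type*} (A : Set α) (f : α → α) (hA : A ⊆ f '' A) :
    Cardinal.mk (⋃ n : ℕ, f^[n] '' A : Set α) ≤ Cardinal.mk A := by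
  rcases A.finite_or_infinite with hfin | hinf
  · have heq : A = f '' A :=
      Set.eq_of_subset_of_ncard_le hA (Set.ncard_image_le hfin) (hfin.image f)
    refine Cardinal.mk_le_mk_of_subset (Set.iUnion_subset fun n => ?_)
    rintro _ ⟨a, ha, rfl⟩
    have hmaps : Set.MapsTo f A A := fun x hx => heq ▸ Set.mem_image_of_mem f hx
    exact hmaps.iterate n ha
  · have haleph : Cardinal.aleph0 ≤ Cardinal.mk A := Cardinal.infinite_iff.mp hinf.to_subtype
    let F : ℕ × A → (⋃ n : ℕ, f^[n] '' A : Set α) := fun p =>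
      ⟨f^[p.1] p.2, Set.mem_iUnion.mpr ⟨p.1, p.2, p.2.2, rfl⟩⟩
    have hF : Function.Surjective F := by
      rintro ⟨x, hx⟩
      obtain ⟨n, a, ha, rfl⟩ := Set.mem_iUnion.mp hx
      exact ⟨(n, ⟨a, ha⟩), rfl⟩
    calc Cardinal.mk (⋃ n : ℕ, f^[n] '' A : Set α) ≤ Cardinal.mk (ℕ × A) :=
          Cardinal.mk_le_of_surjective hF
      _ = Cardinal.mk A := by simp [Cardinal.aleph0_mul_eq haleph]

theorem stmt_1 {α : Type*} (A : Set α) (f : α → α) (hA : A ⊆ f '' A) :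
    ∃ g : α →. α, IsPartialSurjOn g A (⋃ n : ℕ, f^[n] '' A) := by
  obtain ⟨e⟩ := mk_iUnion_iterate_image_le A f hA
  exact exists_isPartialSurjOn_of_embedding e
end

section
/- Let D₁, D₂, Q be pairwise disjoint sets and let f be a partial surjection from D₁ ∪ D₂ onto D₁ ∪ D₂ ∪ Q. Then there exists a partition Q = Q₁ ∪ Q₂ with Q₁ ∩ Q₂ = ∅, together with a partial surjection from D₁ onto D₁ ∪ Q₁ and a partial surjection from D₂ onto D₂ ∪ Q₂. -/
open Cardinal in
theorem IsPartialSurjOn.mk_le {α : Type*} {f : α →. α} {A B : Set α}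
    (hf : IsPartialSurjOn f A B) : #B ≤ #A := by
  obtain ⟨hdom, hran⟩ := hf
  have key : ∀ b : B, ∃ a : A, (b : α) ∈ f a := by
    rintro ⟨b, hb⟩
    rw [← hran] at hb
    obtain ⟨a, ha⟩ := hb
    exact ⟨⟨a, hdom ((PFun.mem_dom f a).2 ⟨b, ha⟩)⟩, ha⟩
  choose s hs using key
  refine mk_le_of_injective (f := s) fun b c hbc => Subtype.ext ?_
  have hb := hs b
  rw [hbc] at hb
  exact Part.mem_unique hb (hs c)

open Cardinal in
theorem exists_isPartialSurjOn_of_mk_le {α : Type*} {A B : Set α} (h : #B ≤ #A) :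
    ∃ g : α →. α, IsPartialSurjOn g A B := by
  obtain ⟨e⟩ := h
  refine ⟨fun a => ⟨∃ b : B, (e b : α) = a, fun ha => (ha.choose : α)⟩, ?_, ?_⟩
  · rintro a ⟨b, rfl⟩
    exact (e b).2
  · ext b
    constructor
    · rintro ⟨a, ha, rfl⟩
      exact ha.choose.2
    · intro hb
      have hex : ∃ c : B, (e c : α) = e ⟨b, hb⟩ := ⟨_, rfl⟩
      refine ⟨e ⟨b, hb⟩, hex, ?_⟩
      exact congrArg Subtype.val (e.injective (Subtype.ext hex.choose_spec))

open Cardinal in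
/-- A set disjoint from `D₁ ∪ D₂` that is absorbed by `D₁ ∪ D₂` is absorbed by the larger of
`D₁` and `D₂`. -/
theorem mk_union_le_of_mk_union_union_le {α : Type*} {D₁ D₂ Q : Set α}
    (hQ : Disjoint (D₁ ∪ D₂) Q) (h : #(D₁ ∪ D₂ ∪ Q : Set α) ≤ #(D₁ ∪ D₂ : Set α))
    (h21 : #D₂ ≤ #D₁) : #(D₁ ∪ Q : Set α) ≤ #D₁ := by
  rcases lt_or_ge #D₁ ℵ₀ with hfin | hinf
  · have hlt : #(D₁ ∪ D₂ : Set α) < ℵ₀ :=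
      (mk_union_le D₁ D₂).trans_lt (add_lt_aleph0 hfin (h21.trans_lt hfin))
    rw [mk_union_of_disjoint hQ] at h
    have hQ0 : #Q = 0 := by
      by_contra hne
      have hQfin : #Q < ℵ₀ := (self_le_add_left _ _).trans_lt (h.trans_lt hlt)
      obtain ⟨m, hm⟩ := lt_aleph0.1 hlt
      obtain ⟨n, hn⟩ := lt_aleph0.1 hQfin
      rw [hm, hn] at h
      rw [hn] at hne
      norm_cast at h hne
      omega
    simpa [hQ0] using mk_union_le D₁ Q
  · calc #(D₁ ∪ Q : Set α) ≤ #(D₁ ∪ D₂ ∪ Q : Set α) :=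
          mk_le_mk_of_subset (Set.union_subset_union_left Q Set.subset_union_left)
      _ ≤ #(D₁ ∪ D₂ : Set α) := h
      _ ≤ #D₁ + #D₂ := mk_union_le D₁ D₂
      _ = #D₁ := add_eq_left hinf h21

theorem stmt_3 {α : Type*} (D₁ D₂ Q : Set α) (f : α →. α)
    (h12 : D₁ ∩ D₂ = ∅) (h1Q : D₁ ∩ Q = ∅) (h2Q : D₂ ∩ Q = ∅)
    (hf : IsPartialSurjOn f (D₁ ∪ D₂) (D₁ ∪ D₂ ∪ Q)) :
    ∃ Q₁ Q₂ : Set α, Q = Q₁ ∪ Q₂ ∧ Q₁ ∩ Q₂ = ∅ ∧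
      (∃ g₁ : α →. α, IsPartialSurjOn g₁ D₁ (D₁ ∪ Q₁)) ∧
      (∃ g₂ : α →. α, IsPartialSurjOn g₂ D₂ (D₂ ∪ Q₂)) := by
  have hQ : Disjoint (D₁ ∪ D₂) Q := Set.disjoint_union_left.2
    ⟨Set.disjoint_iff_inter_eq_empty.2 h1Q, Set.disjoint_iff_inter_eq_empty.2 h2Q⟩
  have h := hf.mk_le
  rcases le_total (Cardinal.mk D₂) (Cardinal.mk D₁) with hle | hle
  · exact ⟨Q, ∅, by simp, by simp,
      exists_isPartialSurjOn_of_mk_le (mk_union_le_of_mk_union_union_le hQ h hle),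
      exists_isPartialSurjOn_of_mk_le (by simp)⟩
  · rw [Set.union_comm D₁ D₂] at hQ h
    exact ⟨∅, Q, by simp, by simp, exists_isPartialSurjOn_of_mk_le (by simp),
      exists_isPartialSurjOn_of_mk_le (mk_union_le_of_mk_union_union_le hQ h hle)⟩
end

section
/- Let A₁, A₂, B₁, B₂ be pairwise disjoint sets and let ⟨f, g⟩ be a surjection pair between A₁ ∪ A₂ and B₁ ∪ B₂. Then there exist pairwise disjoint sets C₁, C₂, C₃, C₄ together with surjection pairs between A₁ and C₁ ∪ C₂, between A₂ and C₃ ∪ C₄, between B₁ and C₁ ∪ C₃, and between B₂ and C₂ ∪ C₄. -/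
/-- `⟨f, g⟩` is a surjection pair between the sets `A` and `B`. -/
def IsSurjPair {α : Type*} (f g : α →. α) (A B : Set α) : Prop :=
  IsPartialSurjOn f A B ∧ IsPartialSurjOn g B A

/-- A partial surjection from `A` onto `B` yields an injection of `B` into `A`. -/
theorem IsPartialSurjOn.exists_injective {α : Type*} {f : α →. α} {A B : Set α}
    (hf : IsPartialSurjOn f A B) : ∃ i : B → A, Function.Injective i := by
  have h (b : B) : ∃ a : A, b.1 ∈ f a := by
    obtain ⟨a, ha⟩ : b.1 ∈ f.ran := hf.2 ▸ b.2
    exact ⟨⟨a, hf.1 ((PFun.mem_dom f a).2 ⟨b, ha⟩)⟩, ha⟩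
  choose i hi using h
  exact ⟨i, fun b b' hbb' => Subtype.ext (Part.mem_unique (hi b) (hbb' ▸ hi b'))⟩

theorem IsSurjPair.nonempty_equiv {α : Type*} {f g : α →. α} {A B : Set α}
    (h : IsSurjPair f g A B) : Nonempty (A ≃ B) := by
  obtain ⟨i, hi⟩ := h.2.exists_injective
  obtain ⟨j, hj⟩ := h.1.exists_injective
  obtain ⟨e, he⟩ := Function.Embedding.schroeder_bernstein hi hj
  exact ⟨Equiv.ofBijective e he⟩

theorem Equiv.exists_isPartialSurjOn {α : Type*} {A B : Set α} (e : A ≃ B) :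
    ∃ f : α →. α, IsPartialSurjOn f A B := by
  refine ⟨fun a => ⟨a ∈ A, fun h => e ⟨a, h⟩⟩, fun a h => h, ?_⟩
  ext b
  constructor
  · rintro ⟨a, h, rfl⟩
    exact (e ⟨a, h⟩).2
  · intro hb
    exact ⟨e.symm ⟨b, hb⟩, (e.symm ⟨b, hb⟩).2, by simp⟩

theorem Equiv.exists_isSurjPair {α : Type*} {A B : Set α} (e : A ≃ B) :
    ∃ f g : α →. α, IsSurjPair f g A B := by
  obtain ⟨f, hf⟩ := e.exists_isPartialSurjOn
  obtain ⟨g, hg⟩ := e.symm.exists_isPartialSurjOn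
  exact ⟨f, g, hf, hg⟩

open Classical in
theorem Equiv.exists_bijOn {α : Type*} {A B : Set α} (e : A ≃ B) :
    ∃ f : α → α, Set.BijOn f A B := by
  refine ⟨fun a => if h : a ∈ A then e ⟨a, h⟩ else a, ?_, ?_, ?_⟩
  · intro a ha
    simp [ha]
  · intro a ha a' ha' h
    simpa [ha, ha', Subtype.val_inj] using h
  · intro b hb
    exact ⟨e.symm ⟨b, hb⟩, (e.symm ⟨b, hb⟩).2, by simp⟩

theorem Set.BijOn.inter_preimage {α : Type*} {f : α → α} {A B S : Set α}
    (h : BijOn f A B) (hS : S ⊆ B) : BijOn f (A ∩ f ⁻¹' S) S := by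
  refine ⟨fun a ha => ha.2, h.injOn.mono inter_subset_left, fun b hb => ?_⟩
  obtain ⟨a, ha, rfl⟩ := h.surjOn (hS hb)
  exact ⟨a, ⟨ha, hb⟩, rfl⟩

theorem stmt_4 {α : Type*} (A₁ A₂ B₁ B₂ : Set α) (f g : α →. α)
    (hdisj : Pairwise (Function.onFun Disjoint ![A₁, A₂, B₁, B₂]))
    (hfg : IsSurjPair f g (A₁ ∪ A₂) (B₁ ∪ B₂)) :
    ∃ C₁ C₂ C₃ C₄ : Set α,
      Pairwise (Function.onFun Disjoint ![C₁, C₂, C₃, C₄]) ∧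
      (∃ u v : α →. α, IsSurjPair u v A₁ (C₁ ∪ C₂)) ∧
      (∃ u v : α →. α, IsSurjPair u v A₂ (C₃ ∪ C₄)) ∧
      (∃ u v : α →. α, IsSurjPair u v B₁ (C₁ ∪ C₃)) ∧
      (∃ u v : α →. α, IsSurjPair u v B₂ (C₂ ∪ C₄)) := by
  obtain ⟨e⟩ := hfg.nonempty_equiv
  obtain ⟨φ, hφ⟩ := e.exists_bijOn
  have hA : Disjoint A₁ A₂ := hdisj (show (0 : Fin 4) ≠ 1 by decide)
  have hB : Disjoint B₁ B₂ := hdisj (show (2 : Fin 4) ≠ 3 by decide)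
  have hB' : Disjoint (φ ⁻¹' B₁) (φ ⁻¹' B₂) := hB.preimage φ
  have hmaps : A₁ ∪ A₂ ⊆ φ ⁻¹' B₁ ∪ φ ⁻¹' B₂ := hφ.mapsTo
  refine ⟨A₁ ∩ φ ⁻¹' B₁, A₁ ∩ φ ⁻¹' B₂, A₂ ∩ φ ⁻¹' B₁, A₂ ∩ φ ⁻¹' B₂, ?_, ?_, ?_, ?_, ?_⟩
  · rw [Set.disjoint_left] at hA hB'
    intro i j hij
    fin_cases i <;> fin_cases j <;> simp [Function.onFun, Set.disjoint_left] at hij ⊢ <;>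
      grind
  · refine (Equiv.setCongr ?_).exists_isSurjPair
    rw [← Set.inter_union_distrib_left, Set.inter_eq_left.2 (Set.subset_union_left.trans hmaps)]
  · refine (Equiv.setCongr ?_).exists_isSurjPair
    rw [← Set.inter_union_distrib_left, Set.inter_eq_left.2 (Set.subset_union_right.trans hmaps)]
  · rw [← Set.union_inter_distrib_right]
    exact ((hφ.inter_preimage Set.subset_union_left).equiv φ).symm.exists_isSurjPair
  · rw [← Set.union_inter_distrib_right]
    exact ((hφ.inter_preimage Set.subset_union_right).equiv φ).symm.exists_isSurjPair
end
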